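/- Let F and G be summable ball kernels, let ψ be an ultrametric wavelet with ball J and φ an ultrametric wavelet with ball I, and suppose that either I ∩ J = ∅ or I = J. Then for any a, b ∈ ℂ the function v(x, t) = a e^{−η_J t} ψ(x) + b e^{−η_I t} φ(x) (where η_J, η_I are formed from the kernel G) satisfies the quadratic cascade equation for all x ∈ ℚ_p and all t > 0. -/

import Mathlib

open MeasureTheory

/-- The index (base-`p` logarithm of the radius) of the smallest ball of `ℚ_[p]`
containing the two points `x` and `y` (for `x ≠ y`): its radius is `‖x - y‖ = p ^ (-(x-y).valuation)`. -/
noncomputable def supIdx {p : ℕ} [Fact p.Prime] (x y : ℚ_[p]) : ℤ := -(x - y).valuation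

/-- The index of the smallest ball containing the three points `x`, `ξ`, `η`
(for pairwise distinct points): its radius is `max (‖x-ξ‖, ‖x-η‖, ‖ξ-η‖)`. -/
noncomputable def sup3Idx {p : ℕ} [Fact p.Prime] (x ξ η : ℚ_[p]) : ℤ :=
  max (supIdx x ξ) (max (supIdx x η) (supIdx ξ η))

/-- A ball kernel: a function on balls of `ℚ_[p]`, encoded as a function of a center and
an index (log_p of the radius), independent of the choice of center in the ball. -/
def IsBallKernel {p : ℕ} [Fact p.Prime] (F : ℚ_[p] → ℤ → ℂ) : Prop :=
  ∀ c c' : ℚ_[p], ∀ γ : ℤ, dist c c' ≤ (p : ℝ) ^ γ → F c γ = F c' γ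

/-- Summability of a ball kernel: for every ball `B(c, p^γ₀)`,
`Σ_{γ > γ₀} ‖F(B(c, p^γ))‖ (p^γ - p^(γ-1)) < ∞`. -/
def KernelSummable {p : ℕ} [Fact p.Prime] (F : ℚ_[p] → ℤ → ℂ) : Prop :=
  ∀ c : ℚ_[p], ∀ γ₀ : ℤ, Summable (fun n : ℕ =>
    ‖F c (γ₀ + 1 + n)‖ * ((p : ℝ) ^ (γ₀ + 1 + (n : ℤ)) - (p : ℝ) ^ (γ₀ + (n : ℤ))))

/-- An ultrametric wavelet with ball `B(c, p^γ)`: vanishes outside the ball, is constant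
on each of the `p` maximal subballs (balls of radius `p^(γ-1)`), has zero mean, and is
not identically zero. -/
def IsWavelet {p : ℕ} [Fact p.Prime] [MeasurableSpace ℚ_[p]] (μ : Measure ℚ_[p])
    (ψ : ℚ_[p] → ℂ) (c : ℚ_[p]) (γ : ℤ) : Prop :=
  (∀ x, (p : ℝ) ^ γ < dist x c → ψ x = 0) ∧
    (∀ x y, dist x y ≤ (p : ℝ) ^ (γ - 1) → ψ x = ψ y) ∧
    (∫ x, ψ x ∂μ) = 0 ∧ ψ ≠ 0

/-- The eigenvalue `λ_I = T(I) ν(I) + Σ_{J > I} T(J) (ν(J) - ν(J,I))` attached to the ball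
`I = B(c, p^γI)` and the ball kernel `T`. -/
noncomputable def lamBall {p : ℕ} [Fact p.Prime] (T : ℚ_[p] → ℤ → ℂ) (c : ℚ_[p]) (γI : ℤ) : ℂ :=
  T c γI * (((p : ℝ) ^ γI : ℝ) : ℂ) +
    ∑' n : ℕ, T c (γI + 1 + n) *
      (((p : ℝ) ^ (γI + 1 + (n : ℤ)) - (p : ℝ) ^ (γI + (n : ℤ)) : ℝ) : ℂ)

/-- The coefficient `Φ_{I,J}` for balls `J = B(c, p^γJ) ⊊ I = B(c, p^γI)`. -/
noncomputable def PhiIJ {p : ℕ} [Fact p.Prime] (F : ℚ_[p] → ℤ → ℂ) (c : ℚ_[p])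
    (γI γJ : ℤ) : ℂ :=
  (((p : ℝ) ^ (2 * (γI - 1)) : ℝ) : ℂ) * F c γI - (((p : ℝ) ^ (2 * γJ) : ℝ) : ℂ) * F c γJ -
    ∑ γ ∈ Finset.Ioo γJ γI, (((p : ℝ) ^ (2 * γ) - (p : ℝ) ^ (2 * γ - 2) : ℝ) : ℂ) * F c γ

/-- The (spatial) operator of the quadratic cascade equation:
`∫∫ F(sup(x,ξ,η)) f(ξ)(f(η) - f(x)) dμ(ξ) dμ(η) + ∫ G(sup(x,ξ))(f(x) - f(ξ)) dμ(ξ)`. -/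
noncomputable def cascadeOp {p : ℕ} [Fact p.Prime] [MeasurableSpace ℚ_[p]]
    (μ : Measure ℚ_[p]) (F G : ℚ_[p] → ℤ → ℂ) (f : ℚ_[p] → ℂ) (x : ℚ_[p]) : ℂ :=
  (∫ ξ, ∫ η, F x (sup3Idx x ξ η) * (f ξ * (f η - f x)) ∂μ ∂μ) +
    ∫ ξ, G x (supIdx x ξ) * (f x - f ξ) ∂μ

/-- `v` satisfies the quadratic cascade equation
`∂ₜ v(x,t) + ∫∫ F(sup(x,ξ,η)) v(ξ,t)(v(η,t) - v(x,t)) dμ(ξ) dμ(η)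
  + ∫ G(sup(x,ξ))(v(x,t) - v(ξ,t)) dμ(ξ) = 0` for all `x ∈ ℚ_p` and all `t > 0`. -/
def SatisfiesCascade {p : ℕ} [Fact p.Prime] [MeasurableSpace ℚ_[p]]
    (μ : Measure ℚ_[p]) (F G : ℚ_[p] → ℤ → ℂ) (v : ℚ_[p] → ℝ → ℂ) : Prop :=
  ∀ x : ℚ_[p], ∀ t : ℝ, 0 < t →
    HasDerivAt (fun s => v x s) (-(cascadeOp μ F G (fun y => v y t) x)) t


section helpers
set_option linter.unusedSectionVars false
variable {p : ℕ} [Fact p.Prime]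

lemma aux_one_lt_p : (1 : ℝ) < p := by exact_mod_cast (Fact.out : p.Prime).one_lt

lemma aux_dist_eq {x y : ℚ_[p]} (h : x ≠ y) : dist x y = (p : ℝ) ^ supIdx x y := by
  rw [dist_eq_norm, Padic.norm_eq_zpow_neg_valuation (sub_ne_zero.2 h)]; rfl

lemma aux_idx_le {x y : ℚ_[p]} (h : x ≠ y) (γ : ℤ) :
    supIdx x y ≤ γ ↔ dist x y ≤ (p : ℝ) ^ γ := by
  rw [aux_dist_eq h, zpow_le_zpow_iff_right₀ aux_one_lt_p]

lemma aux_idx_eq_of_dist {x y z : ℚ_[p]} (h : x ≠ y) (h' : x ≠ z) (hd : dist x y = dist x z) :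
    supIdx x y = supIdx x z := by
  rw [aux_dist_eq h, aux_dist_eq h'] at hd
  exact zpow_right_injective₀ (by linarith [aux_one_lt_p (p := p)]) aux_one_lt_p.ne' hd

lemma aux_sup3 {x ξ η : ℚ_[p]} (h1 : x ≠ ξ) (h2 : x ≠ η) (h3 : ξ ≠ η) :
    sup3Idx x ξ η = max (supIdx x ξ) (supIdx x η) := by
  have : supIdx ξ η ≤ max (supIdx x ξ) (supIdx x η) := by
    rw [aux_idx_le h3]
    refine (dist_triangle_max ξ x η).trans (max_le ?_ ?_)
    · rw [dist_comm, ← aux_idx_le h1]; exact le_max_left _ _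
    · rw [← aux_idx_le h2]; exact le_max_right _ _
  unfold sup3Idx
  rw [← max_assoc]
  exact max_eq_left this

/-- Points outside a ball see all points of the ball at the same distance. -/
lemma aux_dist_outside {x c ξ : ℚ_[p]} {r : ℝ} (hx : r < dist x c) (hξ : dist ξ c ≤ r) :
    dist x ξ = dist x c := by
  have h1 := dist_triangle_max x ξ c
  have h2 := dist_triangle_max x c ξ
  rw [dist_comm c ξ] at h2
  apply le_antisymm
  · refine h2.trans (max_le le_rfl (by linarith))
  · rcases le_max_iff.1 h1 with h | h
    · exact h
    · linarith

lemma aux_lt_zpow {y : ℝ} {n γ : ℤ} (hy : y = (p : ℝ) ^ n) : ¬ y ≤ (p : ℝ) ^ (γ - 1) ↔ γ ≤ n := by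
  rw [hy, zpow_le_zpow_iff_right₀ aux_one_lt_p]; omega

variable [MeasurableSpace ℚ_[p]] [BorelSpace ℚ_[p]] (μ : Measure ℚ_[p]) [μ.IsAddHaarMeasure]

lemma aux_ae_ne (x : ℚ_[p]) : ∀ᵐ y ∂μ, x ≠ y := by
  have : μ {x} = 0 := measure_singleton x
  rw [ae_iff]
  convert this using 2
  ext y; simp [eq_comm]

lemma aux_quad_const (F : ℚ_[p] → ℤ → ℂ) (f : ℚ_[p] → ℂ) (x c : ℚ_[p]) (γ : ℤ)
    (hf : ∀ y z, dist y c ≤ (p : ℝ) ^ γ → dist y z ≤ (p : ℝ) ^ (γ - 1) → f y = f z) :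
    ∃ C : ℂ, ∀ ξ, x ≠ ξ → dist ξ c ≤ (p : ℝ) ^ γ →
      ∫ η, F x (sup3Idx x ξ η) * (f η - f x) ∂μ = C := by
  by_cases hx : dist x c ≤ (p : ℝ) ^ γ
  · refine ⟨∫ η, F x (supIdx x η) * (f η - f x) ∂μ, fun ξ h1 hξ => ?_⟩
    apply integral_congr_ae
    filter_upwards [aux_ae_ne μ x, aux_ae_ne μ ξ] with η h2 h3
    by_cases hη : dist x η ≤ (p : ℝ) ^ (γ - 1)
    · simp [hf x η hx hη]
    · rw [aux_lt_zpow (aux_dist_eq h2)] at hη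
      have : supIdx x ξ ≤ γ := by
        rw [aux_idx_le h1]
        refine (dist_triangle_max x c ξ).trans (max_le hx ?_)
        rwa [dist_comm]
      rw [aux_sup3 h1 h2 h3, max_eq_right (this.trans hη)]
  · push Not at hx
    refine ⟨∫ η, F x (max (supIdx x c) (supIdx x η)) * (f η - f x) ∂μ, fun ξ h1 hξ => ?_⟩
    apply integral_congr_ae
    filter_upwards [aux_ae_ne μ x, aux_ae_ne μ ξ] with η h2 h3
    have hxc : x ≠ c := by
      rintro rfl
      rw [dist_self] at hx
      have : (0 : ℝ) < (p : ℝ) ^ γ := zpow_pos (by linarith [aux_one_lt_p (p := p)]) _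
      linarith
    rw [aux_sup3 h1 h2 h3, aux_idx_eq_of_dist h1 hxc (aux_dist_outside hx hξ)]

lemma aux_integrable {ψ : ℚ_[p] → ℂ} {c : ℚ_[p]} {γ : ℤ} (h : IsWavelet μ ψ c γ) :
    Integrable ψ μ := by
  have hpos : (0 : ℝ) < (p : ℝ) ^ (γ - 1) := zpow_pos (by linarith [aux_one_lt_p (p := p)]) _
  apply Continuous.integrable_of_hasCompactSupport
  · rw [Metric.continuous_iff]
    intro b ε hε
    refine ⟨_, hpos, fun a ha => ?_⟩
    rw [h.2.1 a b ha.le, dist_self]; exact hε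
  · refine HasCompactSupport.intro (isCompact_closedBall c ((p : ℝ) ^ γ)) fun x hx => ?_
    exact h.1 x (by simpa using hx)

/-- The quadratic term vanishes. -/
lemma aux_quad_zero (F : ℚ_[p] → ℤ → ℂ) (ψ φ : ℚ_[p] → ℂ) (cJ cI : ℚ_[p]) (γJ γI : ℤ)
    (hψ : IsWavelet μ ψ cJ γJ) (hφ : IsWavelet μ φ cI γI) (A B : ℂ) (f : ℚ_[p] → ℂ)
    (hf : f = fun x => A * ψ x + B * φ x)
    (hJ : ∀ y z, dist y cJ ≤ (p : ℝ) ^ γJ → dist y z ≤ (p : ℝ) ^ (γJ - 1) → f y = f z)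
    (hI : ∀ y z, dist y cI ≤ (p : ℝ) ^ γI → dist y z ≤ (p : ℝ) ^ (γI - 1) → f y = f z)
    (x : ℚ_[p]) :
    ∫ ξ, ∫ η, F x (sup3Idx x ξ η) * (f ξ * (f η - f x)) ∂μ ∂μ = 0 := by
  obtain ⟨C, hC⟩ := aux_quad_const μ F f x cJ γJ hJ
  obtain ⟨D, hD⟩ := aux_quad_const μ F f x cI γI hI
  have h1 : ∫ ξ, ∫ η, F x (sup3Idx x ξ η) * (f ξ * (f η - f x)) ∂μ ∂μ =
      ∫ ξ, ((A * C) * ψ ξ + (B * D) * φ ξ) ∂μ := by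
    apply integral_congr_ae
    filter_upwards [aux_ae_ne μ x] with ξ h
    have e : ∫ η, F x (sup3Idx x ξ η) * (f ξ * (f η - f x)) ∂μ =
        f ξ * ∫ η, F x (sup3Idx x ξ η) * (f η - f x) ∂μ := by
      rw [← integral_const_mul]
      congr 1; ext η; ring
    rw [e]
    have e1 : ψ ξ * ∫ η, F x (sup3Idx x ξ η) * (f η - f x) ∂μ = ψ ξ * C := by
      by_cases hξ : dist ξ cJ ≤ (p : ℝ) ^ γJ
      · rw [hC ξ h hξ]
      · rw [hψ.1 ξ (not_le.1 hξ)]; simp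
    have e2 : φ ξ * ∫ η, F x (sup3Idx x ξ η) * (f η - f x) ∂μ = φ ξ * D := by
      by_cases hξ : dist ξ cI ≤ (p : ℝ) ^ γI
      · rw [hD ξ h hξ]
      · rw [hφ.1 ξ (not_le.1 hξ)]; simp
    have e3 : f ξ = A * ψ ξ + B * φ ξ := by rw [hf]
    rw [e3]
    linear_combination A * e1 + B * e2
  rw [h1, integral_add ((aux_integrable μ hψ).const_mul _) ((aux_integrable μ hφ).const_mul _),
    integral_const_mul, integral_const_mul, hψ.2.2.1, hφ.2.2.1]
  simp

lemma aux_ball_succ (γ : ℤ) :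
    Metric.closedBall (0 : ℚ_[p]) ((p : ℝ) ^ (γ + 1)) =
      ⋃ n ∈ Finset.range p, Metric.closedBall ((n : ℚ_[p]) * (p : ℚ_[p]) ^ (-(γ + 1)))
        ((p : ℝ) ^ γ) := by
  have hp0 : (0 : ℝ) < p := by linarith [aux_one_lt_p (p := p)]
  have hpp : (p : ℚ_[p]) ≠ 0 := by exact_mod_cast (Fact.out : p.Prime).ne_zero
  ext y
  simp only [Metric.mem_closedBall, Set.mem_iUnion, Finset.mem_range, exists_prop, dist_zero_right]
  constructor
  · intro hy
    have hz : ‖y * (p : ℚ_[p]) ^ (γ + 1)‖ ≤ 1 := by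
      rw [norm_mul, Padic.norm_p_zpow, zpow_neg]
      exact mul_inv_le_one_of_le₀ hy (zpow_pos hp0 _).le
    obtain ⟨w, hw⟩ : ∃ w : ℤ_[p], (w : ℚ_[p]) = y * (p : ℚ_[p]) ^ (γ + 1) := ⟨⟨_, hz⟩, rfl⟩
    obtain ⟨n, hn, hm⟩ := PadicInt.exists_mem_range w
    refine ⟨n, hn, ?_⟩
    rw [IsLocalRing.mem_maximalIdeal, PadicInt.mem_nonunits, PadicInt.norm_def,
      PadicInt.coe_sub, PadicInt.coe_natCast, hw] at hm
    have e : y - (n : ℚ_[p]) * (p : ℚ_[p]) ^ (-(γ + 1)) =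
        (y * (p : ℚ_[p]) ^ (γ + 1) - (n : ℚ_[p])) * (p : ℚ_[p]) ^ (-(γ + 1)) := by
      rw [sub_mul, mul_assoc, ← zpow_add₀ hpp]; simp
    rw [dist_eq_norm, Padic.norm_le_pow_iff_norm_lt_pow_add_one, e, norm_mul, Padic.norm_p_zpow,
      neg_neg]
    exact mul_lt_of_lt_one_left (zpow_pos hp0 _) hm
  · rintro ⟨n, hn, h⟩
    have h1 : ‖(n : ℚ_[p]) * (p : ℚ_[p]) ^ (-(γ + 1))‖ ≤ (p : ℝ) ^ (γ + 1) := by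
      rw [norm_mul, Padic.norm_p_zpow, neg_neg]
      exact mul_le_of_le_one_left (zpow_pos hp0 _).le (by exact_mod_cast Padic.norm_int_le_one n)
    have h2 := dist_triangle_max y ((n : ℚ_[p]) * (p : ℚ_[p]) ^ (-(γ + 1))) 0
    rw [dist_zero_right, dist_zero_right] at h2
    refine h2.trans (max_le (h.trans ?_) h1)
    exact zpow_le_zpow_right₀ aux_one_lt_p.le (by omega)

lemma aux_real_ball (x : ℚ_[p]) (r : ℝ) :
    μ.real (Metric.closedBall x r) = μ.real (Metric.closedBall 0 r) := by
  have h : Metric.closedBall x r = (fun y => -x + y) ⁻¹' (Metric.closedBall 0 r) := by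
    ext y; simp [dist_eq_norm, neg_add_eq_sub]
  rw [measureReal_def, measureReal_def, h, measure_preimage_add]

lemma aux_real_succ (γ : ℤ) :
    μ.real (Metric.closedBall (0 : ℚ_[p]) ((p : ℝ) ^ (γ + 1))) =
      p * μ.real (Metric.closedBall (0 : ℚ_[p]) ((p : ℝ) ^ γ)) := by
  have hp0 : (0 : ℝ) < p := by linarith [aux_one_lt_p (p := p)]
  rw [aux_ball_succ, measureReal_biUnion_finset ?_ ?_
    (fun n _ => (isCompact_closedBall _ _).measure_lt_top.ne)]
  · simp_rw [aux_real_ball μ _ ((p : ℝ) ^ γ)]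
    simp
  · intro m hm n hn hmn
    refine Set.disjoint_left.2 fun y h1 h2 => ?_
    rw [Metric.mem_closedBall] at h1 h2
    rw [dist_comm] at h1
    have h := (dist_triangle_max _ y _).trans (max_le h1 h2)
    rw [dist_eq_norm, ← sub_mul, norm_mul, Padic.norm_p_zpow, neg_neg] at h
    have h3 : ‖(((m : ℤ) - (n : ℤ) : ℤ) : ℚ_[p])‖ < 1 := by
      push_cast
      by_contra h4
      push Not at h4
      have h5 : (p : ℝ) ^ (γ + 1) ≤ (p : ℝ) ^ γ :=
        (le_mul_of_one_le_left (zpow_pos hp0 _).le h4).trans h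
      rw [zpow_le_zpow_iff_right₀ aux_one_lt_p] at h5
      omega
    rw [Padic.norm_intCast_lt_one_iff] at h3
    simp only [Finset.coe_range, Set.mem_Iio] at hm hn
    apply hmn
    have := Int.eq_zero_of_abs_lt_dvd h3 (by rw [abs_lt]; omega)
    omega
  · intro n _; exact Metric.isClosed_closedBall.measurableSet

lemma aux_measure (hμ : μ (Metric.closedBall 0 1) = 1) (x : ℚ_[p]) (γ : ℤ) :
    μ.real (Metric.closedBall x ((p : ℝ) ^ γ)) = (p : ℝ) ^ γ := by
  have hp0 : (p : ℝ) ≠ 0 := by linarith [aux_one_lt_p (p := p)]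
  rw [aux_real_ball]
  induction γ using Int.induction_on with
  | zero => simp [measureReal_def, hμ]
  | succ i ih => rw [aux_real_succ, ih, zpow_add_one₀ hp0]; ring
  | pred i ih =>
    have := aux_real_succ μ (-(i : ℤ) - 1)
    rw [sub_add_cancel, ih] at this
    have e : (p : ℝ) ^ (-(i : ℤ)) = p * (p : ℝ) ^ (-(i : ℤ) - 1) := by
      rw [zpow_sub_one₀ hp0]; field_simp
    exact (mul_left_cancel₀ hp0 (e.symm.trans this)).symm

/-- integral of the kernel outside of a ball -/
lemma aux_outside (hμ : μ (Metric.closedBall 0 1) = 1) (G : ℚ_[p] → ℤ → ℂ)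
    (hGs : KernelSummable G) (x : ℚ_[p]) (γ : ℤ) :
    IntegrableOn (fun ξ => G x (supIdx x ξ)) (Metric.closedBall x ((p : ℝ) ^ γ))ᶜ μ ∧
    ∫ ξ in (Metric.closedBall x ((p : ℝ) ^ γ))ᶜ, G x (supIdx x ξ) ∂μ =
      ∑' n : ℕ, G x (γ + 1 + n) *
        (((p : ℝ) ^ (γ + 1 + (n : ℤ)) - (p : ℝ) ^ (γ + (n : ℤ)) : ℝ) : ℂ) := by
  have hp0 : (0 : ℝ) < p := by linarith [aux_one_lt_p (p := p)]
  let S : ℕ → Set ℚ_[p] := fun n =>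
    Metric.closedBall x ((p : ℝ) ^ (γ + 1 + (n : ℤ))) \ Metric.closedBall x ((p : ℝ) ^ (γ + (n : ℤ)))
  have hS : ∀ n ξ, ξ ∈ S n ↔ x ≠ ξ ∧ supIdx x ξ = γ + 1 + n := by
    intro n ξ
    by_cases hx : x = ξ
    · subst hx
      simp [S, (zpow_pos hp0 _).le]
    · simp only [S, Set.mem_sdiff, Metric.mem_closedBall, dist_comm ξ x, ← aux_idx_le hx]
      constructor
      · rintro ⟨h1, h2⟩; exact ⟨hx, by omega⟩
      · rintro ⟨h1, h2⟩; omega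
  have hU : (Metric.closedBall x ((p : ℝ) ^ γ))ᶜ = ⋃ n, S n := by
    ext ξ
    simp only [Set.mem_compl_iff, Set.mem_iUnion, hS]
    by_cases hx : x = ξ
    · subst hx
      simp [(zpow_pos hp0 _).le]
    · simp only [Metric.mem_closedBall, dist_comm ξ x, ← aux_idx_le hx]
      constructor
      · intro h
        exact ⟨(supIdx x ξ - γ - 1).toNat, hx, by omega⟩
      · rintro ⟨n, h1, h2⟩; omega
  have hm : ∀ n, MeasurableSet (S n) := fun n =>
    Metric.isClosed_closedBall.measurableSet.diff Metric.isClosed_closedBall.measurableSet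
  have hμS : ∀ n, μ.real (S n) = (p : ℝ) ^ (γ + 1 + (n : ℤ)) - (p : ℝ) ^ (γ + (n : ℤ)) := by
    intro n
    simp only [S]
    rw [measureReal_sdiff (Metric.closedBall_subset_closedBall
      (zpow_le_zpow_right₀ aux_one_lt_p.le (by omega))) Metric.isClosed_closedBall.measurableSet
      (isCompact_closedBall _ _).measure_lt_top.ne, aux_measure μ hμ, aux_measure μ hμ]
  have hfin : ∀ n, μ (S n) < ⊤ := fun n =>
    (measure_mono Set.sdiff_subset).trans_lt (isCompact_closedBall _ _).measure_lt_top
  have hd : Pairwise (Function.onFun Disjoint S) := by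
    intro m n hmn
    refine Set.disjoint_left.2 fun y h1 h2 => ?_
    rw [hS] at h1 h2
    omega
  have hi : ∀ n, IntegrableOn (fun ξ => G x (supIdx x ξ)) (S n) μ := by
    intro n
    refine (integrableOn_const (C := G x (γ + 1 + n)) (hfin n).ne).congr_fun ?_ (hm n)
    intro ξ hξ
    simp only [((hS n ξ).1 hξ).2]
  have hint : IntegrableOn (fun ξ => G x (supIdx x ξ)) (⋃ n, S n) μ := by
    apply integrableOn_iUnion_of_summable_integral_norm hi
    convert hGs x γ using 2 with n
    rw [setIntegral_congr_fun (g := fun _ => ‖G x (γ + 1 + n)‖) (hm n)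
      (fun ξ hξ => by simp only [((hS n ξ).1 hξ).2]), setIntegral_const, hμS, smul_eq_mul, mul_comm]
  rw [hU]
  refine ⟨hint, ?_⟩
  rw [← (hasSum_integral_iUnion hm hd hint).tsum_eq]
  congr 1; ext n
  rw [setIntegral_congr_fun (g := fun _ => G x (γ + 1 + n)) (hm n)
      (fun ξ hξ => by simp only [((hS n ξ).1 hξ).2]), setIntegral_const, hμS, mul_comm,
      Complex.real_smul]

lemma aux_lam {G : ℚ_[p] → ℤ → ℂ} (hG : IsBallKernel G) {x c : ℚ_[p]} {γ : ℤ}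
    (h : dist x c ≤ (p : ℝ) ^ γ) : lamBall G c γ = lamBall G x γ := by
  have key : ∀ δ, γ ≤ δ → G c δ = G x δ := fun δ hδ =>
    (hG x c δ (h.trans (zpow_le_zpow_right₀ aux_one_lt_p.le hδ))).symm
  unfold lamBall
  rw [key γ le_rfl]
  congr 2; ext n
  rw [key _ (by omega)]

lemma aux_linear (hμ : μ (Metric.closedBall 0 1) = 1) (G : ℚ_[p] → ℤ → ℂ) (hG : IsBallKernel G)
    (hGs : KernelSummable G) {ψ : ℚ_[p] → ℂ} {c : ℚ_[p]} {γ : ℤ} (h : IsWavelet μ ψ c γ)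
    (x : ℚ_[p]) :
    Integrable (fun ξ => G x (supIdx x ξ) * (ψ x - ψ ξ)) μ ∧
    ∫ ξ, G x (supIdx x ξ) * (ψ x - ψ ξ) ∂μ = lamBall G c γ * ψ x := by
  have hψi := aux_integrable μ h
  have hp0 : (0 : ℝ) < p := by linarith [aux_one_lt_p (p := p)]
  by_cases hx : dist x c ≤ (p : ℝ) ^ γ
  · set U := Metric.closedBall x ((p : ℝ) ^ γ) with hU
    have hUm : MeasurableSet U := Metric.isClosed_closedBall.measurableSet
    have hUf : μ U ≠ ⊤ := (isCompact_closedBall _ _).measure_lt_top.ne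
    obtain ⟨o1, o2⟩ := aux_outside μ hμ G hGs x γ
    rw [← hU] at o1 o2
    have hae : (fun ξ => G x (supIdx x ξ) * (ψ x - ψ ξ)) =ᵐ[μ] fun ξ =>
        (U.indicator (fun _ => G x γ * ψ x) ξ - G x γ * ψ ξ) +
          Uᶜ.indicator (fun ξ => G x (supIdx x ξ)) ξ * ψ x := by
      filter_upwards [aux_ae_ne μ x] with ξ hξ
      by_cases hm : ξ ∈ U
      · have hm' : ξ ∉ Uᶜ := by simpa using hm
        rw [Set.indicator_of_mem hm, Set.indicator_of_notMem hm']
        by_cases hs : dist x ξ ≤ (p : ℝ) ^ (γ - 1)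
        · rw [h.2.1 x ξ hs]; ring
        · rw [aux_lt_zpow (aux_dist_eq hξ)] at hs
          rw [hU, Metric.mem_closedBall, dist_comm, ← aux_idx_le hξ] at hm
          rw [le_antisymm hm hs]; ring
      · have hm' : ξ ∈ Uᶜ := hm
        rw [Set.indicator_of_notMem hm, Set.indicator_of_mem hm']
        have : ψ ξ = 0 := by
          apply h.1
          rw [hU, Metric.mem_closedBall] at hm
          by_contra h4
          push Not at h4
          refine hm ((dist_triangle_max ξ c x).trans (max_le h4 ?_))
          rwa [dist_comm]
        rw [this]; ring
    have i1 : Integrable (U.indicator (fun _ => G x γ * ψ x)) μ :=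
      (integrable_indicator_iff hUm).2 (integrableOn_const hUf)
    have i2 : Integrable (fun ξ => G x γ * ψ ξ) μ := hψi.const_mul _
    have i3 : Integrable (fun ξ => Uᶜ.indicator (fun ξ => G x (supIdx x ξ)) ξ * ψ x) μ :=
      ((integrable_indicator_iff hUm.compl).2 o1).mul_const _
    have i4 : Integrable (fun ξ => U.indicator (fun _ => G x γ * ψ x) ξ - G x γ * ψ ξ) μ :=
      i1.sub i2
    refine ⟨(i4.add i3).congr hae.symm, ?_⟩
    rw [integral_congr_ae hae, integral_add i4 i3, integral_sub i1 i2,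
      integral_mul_const, integral_const_mul, integral_indicator hUm, integral_indicator hUm.compl,
      o2, setIntegral_const, h.2.2.1, aux_measure μ hμ, aux_lam hG hx, lamBall, Complex.real_smul]
    ring
  · push Not at hx
    have hxc : x ≠ c := by
      rintro rfl
      rw [dist_self] at hx
      linarith [zpow_pos hp0 γ]
    have hψx := h.1 x hx
    have hae : (fun ξ => G x (supIdx x ξ) * (ψ x - ψ ξ)) =ᵐ[μ] fun ξ =>
        (-G x (supIdx x c)) * ψ ξ := by
      filter_upwards [aux_ae_ne μ x] with ξ hξ
      rw [hψx]
      by_cases hm : dist ξ c ≤ (p : ℝ) ^ γ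
      · rw [aux_idx_eq_of_dist hξ hxc (aux_dist_outside hx hm)]; ring
      · rw [h.1 ξ (not_le.1 hm)]; ring
    refine ⟨(hψi.const_mul _).congr hae.symm, ?_⟩
    rw [integral_congr_ae hae, integral_const_mul, h.2.2.1, hψx]; simp

/-- Equal balls have equal indices. -/
lemma aux_ball_eq {c d : ℚ_[p]} {γ δ : ℤ}
    (h : Metric.closedBall c ((p : ℝ) ^ γ) ⊆ Metric.closedBall d ((p : ℝ) ^ δ)) : γ ≤ δ := by
  have hp0 : (0 : ℝ) < p := by linarith [aux_one_lt_p (p := p)]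
  have h1 : c ∈ Metric.closedBall d ((p : ℝ) ^ δ) :=
    h (Metric.mem_closedBall_self (zpow_pos hp0 _).le)
  have h2 : c + (p : ℚ_[p]) ^ (-γ) ∈ Metric.closedBall d ((p : ℝ) ^ δ) := h (by simp [dist_eq_norm])
  rw [Metric.mem_closedBall] at h1 h2
  rw [dist_comm] at h1
  have h3 := (dist_triangle_max _ d _).trans (max_le h2 h1)
  rw [dist_eq_norm, add_sub_cancel_left, Padic.norm_p_zpow, neg_neg,
    zpow_le_zpow_iff_right₀ aux_one_lt_p] at h3
  exact h3

/-- local constancy of the combination on the ball of the first wavelet -/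
lemma aux_local {ψ φ : ℚ_[p] → ℂ} {cJ cI : ℚ_[p]} {γJ γI : ℤ}
    (hψ : IsWavelet μ ψ cJ γJ) (hφ : IsWavelet μ φ cI γI)
    (hballs : Disjoint (Metric.closedBall cI ((p : ℝ) ^ γI))
        (Metric.closedBall cJ ((p : ℝ) ^ γJ)) ∨
      Metric.closedBall cI ((p : ℝ) ^ γI) = Metric.closedBall cJ ((p : ℝ) ^ γJ))
    (y z : ℚ_[p]) (hy : dist y cJ ≤ (p : ℝ) ^ γJ) (hz : dist y z ≤ (p : ℝ) ^ (γJ - 1)) :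
    ψ y = ψ z ∧ φ y = φ z := by
  refine ⟨hψ.2.1 y z hz, ?_⟩
  rcases hballs with h | h
  · have key : ∀ w, dist w cJ ≤ (p : ℝ) ^ γJ → φ w = 0 := fun w hw => by
      apply hφ.1
      by_contra h4
      push Not at h4
      exact Set.disjoint_left.1 h h4 hw
    rw [key y hy, key z]
    refine (dist_triangle_max z y cJ).trans (max_le ?_ hy)
    rw [dist_comm]
    exact hz.trans (zpow_le_zpow_right₀ aux_one_lt_p.le (by omega))
  · have : γI = γJ := le_antisymm (aux_ball_eq h.subset) (aux_ball_eq h.symm.subset)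
    subst this
    exact hφ.2.1 y z hz

end helpers

/-- For summable ball kernels `F`, `G` and wavelets `ψ` (ball `J`) and `φ`
(ball `I`) whose balls are either disjoint or equal, the function
`v(x,t) = a e^(-η_J t) ψ(x) + b e^(-η_I t) φ(x)` satisfies the quadratic cascade
equation for all `x` and all `t > 0`. -/
theorem two_wavelet_solution_noninteracting {p : ℕ} [Fact p.Prime]
    [MeasurableSpace ℚ_[p]] [BorelSpace ℚ_[p]]
    (μ : Measure ℚ_[p]) [μ.IsAddHaarMeasure] (hμ : μ (Metric.closedBall 0 1) = 1)
    (F G : ℚ_[p] → ℤ → ℂ) (hF : IsBallKernel F) (hG : IsBallKernel G)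
    (hFs : KernelSummable F) (hGs : KernelSummable G)
    (ψ φ : ℚ_[p] → ℂ) (cJ cI : ℚ_[p]) (γJ γI : ℤ)
    (hψ : IsWavelet μ ψ cJ γJ) (hφ : IsWavelet μ φ cI γI)
    (hballs : Disjoint (Metric.closedBall cI ((p : ℝ) ^ γI))
        (Metric.closedBall cJ ((p : ℝ) ^ γJ)) ∨
      Metric.closedBall cI ((p : ℝ) ^ γI) = Metric.closedBall cJ ((p : ℝ) ^ γJ))
    (a b : ℂ) :
    SatisfiesCascade μ F G
      (fun x t => a * Complex.exp (-(lamBall G cJ γJ) * (t : ℂ)) * ψ x +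
        b * Complex.exp (-(lamBall G cI γI) * (t : ℂ)) * φ x) := by
  intro x t ht
  set A := a * Complex.exp (-(lamBall G cJ γJ) * (t : ℂ)) with hA
  set B := b * Complex.exp (-(lamBall G cI γI) * (t : ℂ)) with hB
  have hop : cascadeOp μ F G (fun y => A * ψ y + B * φ y) x =
      A * (lamBall G cJ γJ * ψ x) + B * (lamBall G cI γI * φ x) := by
    obtain ⟨i1, e1⟩ := aux_linear μ hμ G hG hGs hψ x
    obtain ⟨i2, e2⟩ := aux_linear μ hμ G hG hGs hφ x
    unfold cascadeOp
    rw [aux_quad_zero μ F ψ φ cJ cI γJ γI hψ hφ A B (fun y => A * ψ y + B * φ y) rfl ?_ ?_ x,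
      zero_add, ← e1, ← e2, ← integral_const_mul, ← integral_const_mul,
      ← integral_add (i1.const_mul _) (i2.const_mul _)]
    · congr 1; ext ξ; ring
    · intro y z hy hz
      obtain ⟨h1, h2⟩ := aux_local μ hψ hφ hballs y z hy hz
      simp only [h1, h2]
    · intro y z hy hz
      obtain ⟨h1, h2⟩ := aux_local μ hφ hψ (hballs.imp (fun h => h.symm) Eq.symm) y z hy hz
      simp only [h1, h2]
  rw [hop]
  have hd : ∀ l : ℂ, HasDerivAt (fun s : ℝ => Complex.exp (-l * (s : ℂ)))
      (Complex.exp (-l * (t : ℂ)) * (-l)) t := fun l => by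
    have h1 : HasDerivAt (fun s : ℝ => -l * (s : ℂ)) (-l) t := by
      simpa using (Complex.ofRealCLM.hasDerivAt (x := t)).const_mul (-l)
    exact h1.cexp
  have h1 := ((hd (lamBall G cJ γJ)).const_mul a).mul_const (ψ x)
  have h2 := ((hd (lamBall G cI γI)).const_mul b).mul_const (φ x)
  refine (h1.add h2).congr_deriv ?_
  rw [hA, hB]; ring
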